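/- The number of spanning trees of the fan graph F_n equals the number of ways to partition the path v_2–...–v_n into nonempty consecutive blocks and choose one vertex from each block; equivalently, t_n = Σ over compositions (c_1, ..., c_k) of n−1 of the product c_1·c_2·...·c_k. -/

import Mathlib

open SimpleGraph

/-- The fan graph on `n` vertices: vertex `0` is the hub `v_∞`, and vertices
`1, …, n-1` (representing `v_2, …, v_n`) form a path, each joined to the hub. -/
def fanGraph (n : ℕ) : SimpleGraph (Fin n) :=
  SimpleGraph.fromRel (fun i j =>
    ((i : ℕ) = 0 ∧ (j : ℕ) ≠ 0) ∨ ((i : ℕ) ≠ 0 ∧ (i : ℕ) + 1 = (j : ℕ)))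

/-- `T` is a spanning tree of `G`: a subgraph (on the same vertex set) that is a tree. -/
def IsSpanningTree {V : Type*} (G T : SimpleGraph V) : Prop :=
  T ≤ G ∧ T.IsTree

/-- The number of spanning trees of the fan graph `F_n`. -/
noncomputable def numSpanningTrees (n : ℕ) : ℕ :=
  Nat.card {T : SimpleGraph (Fin n) // IsSpanningTree (fanGraph n) T}

/-- State of the scan: `true` = last block has its hub vertex, `false` = not yet. -/
def scan (E H : Finset ℕ) : ℕ → Bool → Prop
  | 0, true => 1 ∈ H
  | 0, false => 1 ∉ H
  | m+1, true => (m+2 ∈ E ∧ ((scan E H m true ∧ m+2 ∉ H) ∨ (scan E H m false ∧ m+2 ∈ H)))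
      ∨ (m+2 ∉ E ∧ scan E H m true ∧ m+2 ∈ H)
  | m+1, false => m+2 ∉ H ∧ ((m+2 ∈ E ∧ scan E H m false) ∨ (m+2 ∉ E ∧ scan E H m true))

def SB (E : Finset ℕ) (i j : ℕ) : Prop := ∀ k, i < k → k ≤ j → k ∈ E

def HasHub (E H : Finset ℕ) (m i : ℕ) : Prop :=
  ∃ j, 1 ≤ j ∧ j ≤ m ∧ j ∈ H ∧ SB E i j ∧ SB E j i

def Indep (E H : Finset ℕ) (m : ℕ) : Prop :=
  ∀ j k, 1 ≤ j → j < k → k ≤ m → j ∈ H → k ∈ H → ¬ SB E j k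

theorem SB_succ (E : Finset ℕ) (i j : ℕ) (h : i ≤ j) : SB E i (j+1) ↔ SB E i j ∧ j+1 ∈ E := by
  constructor
  · intro hs
    exact ⟨fun k h1 h2 => hs k h1 (by omega), hs _ (by omega) le_rfl⟩
  · rintro ⟨h1, h2⟩ k h3 h4
    rcases Nat.lt_or_ge j k with h5 | h5
    · have : k = j+1 := by omega
      exact this ▸ h2
    · exact h1 k h3 h5

theorem SB_of_le (E : Finset ℕ) (i j : ℕ) (h : j ≤ i) : SB E i j := by
  intro k h1 h2; omega

theorem indep_succ (E H : Finset ℕ) (m : ℕ) : Indep E H (m+1) ↔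
    Indep E H m ∧ (m+1 ∈ H → m+1 ∈ E → ∀ j, 1 ≤ j → j ≤ m → j ∈ H → ¬ SB E j m) := by
  constructor
  · intro h
    refine ⟨fun j k h1 h2 h3 => h j k h1 h2 (by omega), fun h1 h2 j h3 h4 h5 h6 => ?_⟩
    exact h j (m+1) h3 (by omega) le_rfl h5 h1 ((SB_succ E j m h4).2 ⟨h6, h2⟩)
  · rintro ⟨h1, h2⟩ j k h3 h4 h5 h6 h7 h8
    rcases Nat.lt_or_ge m k with h9 | h9
    · have : k = m+1 := by omega
      subst this
      have := (SB_succ E j m (by omega)).1 h8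
      exact h2 h7 this.2 j h3 (by omega) h6 this.1
    · exact h1 j k h3 h4 h9 h6 h7 h8

theorem hasHub_succ (E H : Finset ℕ) (m i : ℕ) (hi : i ≤ m) : HasHub E H (m+1) i ↔
    HasHub E H m i ∨ (m+1 ∈ H ∧ m+1 ∈ E ∧ SB E i m) := by
  constructor
  · rintro ⟨j, h1, h2, h3, h4, h5⟩
    rcases Nat.lt_or_ge m j with h9 | h9
    · have : j = m+1 := by omega
      subst this
      have := (SB_succ E i m (by omega)).1 h4
      exact Or.inr ⟨h3, this.2, this.1⟩
    · exact Or.inl ⟨j, h1, h9, h3, h4, h5⟩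
  · rintro (⟨j, h1, h2, h3, h4, h5⟩ | ⟨h1, h2, h3⟩)
    · exact ⟨j, h1, by omega, h3, h4, h5⟩
    · exact ⟨m+1, by omega, le_rfl, h1, (SB_succ E i m hi).2 ⟨h3, h2⟩, SB_of_le _ _ _ (by omega)⟩

theorem hasHub_last (E H : Finset ℕ) (m : ℕ) : HasHub E H (m+1) (m+1) ↔
    m+1 ∈ H ∨ (m+1 ∈ E ∧ ∃ j, 1 ≤ j ∧ j ≤ m ∧ j ∈ H ∧ SB E j m) := by
  constructor
  · rintro ⟨j, h1, h2, h3, h4, h5⟩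
    rcases Nat.lt_or_ge m j with h9 | h9
    · have : j = m+1 := by omega
      subst this
      exact Or.inl h3
    · have := (SB_succ E j m (by omega)).1 h5
      exact Or.inr ⟨this.2, j, h1, h9, h3, this.1⟩
  · rintro (h | ⟨h0, j, h1, h2, h3, h4⟩)
    · exact ⟨m+1, by omega, le_rfl, h, SB_of_le _ _ _ le_rfl, SB_of_le _ _ _ le_rfl⟩
    · exact ⟨j, h1, by omega, h3, SB_of_le _ _ _ (by omega), (SB_succ E j m h2).2 ⟨h4, h0⟩⟩

def Good (E H : Finset ℕ) (m : ℕ) : Prop :=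
  (∀ i, 1 ≤ i → i ≤ m → HasHub E H m i) ∧ Indep E H m

def Semi (E H : Finset ℕ) (m : ℕ) : Prop :=
  (∀ i, 1 ≤ i → i ≤ m → HasHub E H m i ∨ SB E i m) ∧ Indep E H m ∧
    ∀ j, 1 ≤ j → j ≤ m → j ∈ H → ¬ SB E j m

theorem forall_Icc_succ (P : ℕ → Prop) (m : ℕ) :
    (∀ i, 1 ≤ i → i ≤ m+1 → P i) ↔ (∀ i, 1 ≤ i → i ≤ m → P i) ∧ P (m+1) := by
  constructor
  · intro h; exact ⟨fun i h1 h2 => h i h1 (by omega), h _ (by omega) le_rfl⟩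
  · rintro ⟨h1, h2⟩ i h3 h4
    rcases Nat.lt_or_ge m i with h9 | h9
    · have : i = m+1 := by omega
      exact this ▸ h2
    · exact h1 i h3 h9

theorem hasHub_SB (E H : Finset ℕ) (m i : ℕ) (h : HasHub E H m i) (h' : SB E i m) :
    ∃ j, 1 ≤ j ∧ j ≤ m ∧ j ∈ H ∧ SB E j m := by
  obtain ⟨j, h1, h2, h3, h4, h5⟩ := h
  refine ⟨j, h1, h2, h3, fun k hk hk' => ?_⟩
  rcases Nat.lt_or_ge i k with h9 | h9
  · exact h' k h9 hk'
  · exact h5 k hk h9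

theorem good_succ (E H : Finset ℕ) (m : ℕ) (hm : 1 ≤ m) : Good E H (m+1) ↔
    (m+1 ∈ E ∧ ((Good E H m ∧ m+1 ∉ H) ∨ (Semi E H m ∧ m+1 ∈ H)))
      ∨ (m+1 ∉ E ∧ Good E H m ∧ m+1 ∈ H) := by
  have e1 : (∀ i, 1 ≤ i → i ≤ m → HasHub E H (m+1) i) ↔ ∀ i, 1 ≤ i → i ≤ m →
    (HasHub E H m i ∨ (m+1 ∈ H ∧ m+1 ∈ E ∧ SB E i m)) :=
    forall_congr' fun i => forall_congr' fun _ => forall_congr' fun h => hasHub_succ E H m i h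
  have key : (∀ i, 1 ≤ i → i ≤ m → HasHub E H m i) → 
     ∃ j, 1 ≤ j ∧ j ≤ m ∧ j ∈ H ∧ SB E j m := fun h =>
    hasHub_SB E H m m (h m hm le_rfl) (SB_of_le _ _ _ le_rfl)
  unfold Good Semi
  rw [forall_Icc_succ, hasHub_last, indep_succ, e1]
  by_cases hE : m+1 ∈ E <;> by_cases hH : m+1 ∈ H <;> simp only [hE, hH, true_and, false_and, or_false, false_or, not_true, not_false_iff, and_true, true_or, and_false, forall_true_left, true_implies, false_implies, implies_true]
  · constructor
    · rintro ⟨⟨h1, h2⟩, h3⟩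
      exact ⟨h1, h3⟩
    · rintro ⟨h1, h3⟩
      exact ⟨⟨h1, key h1⟩, h3⟩

theorem semi_succ (E H : Finset ℕ) (m : ℕ) : Semi E H (m+1) ↔
    m+1 ∉ H ∧ ((m+1 ∈ E ∧ Semi E H m) ∨ (m+1 ∉ E ∧ Good E H m)) := by
  have e1 : (∀ i, 1 ≤ i → i ≤ m → HasHub E H (m+1) i ∨ SB E i (m+1)) ↔ ∀ i, 1 ≤ i → i ≤ m →
    ((HasHub E H m i ∨ (m+1 ∈ H ∧ m+1 ∈ E ∧ SB E i m)) ∨ (SB E i m ∧ m+1 ∈ E)) :=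
    forall_congr' fun i => forall_congr' fun _ => forall_congr' fun h => 
      or_congr (hasHub_succ E H m i h) (SB_succ _ _ _ h)
  have e2 : (∀ j, 1 ≤ j → j ≤ m → j ∈ H → ¬ SB E j (m+1)) ↔ ∀ i, 1 ≤ i → i ≤ m →
    i ∈ H → ¬ (SB E i m ∧ m+1 ∈ E) :=
    forall_congr' fun i => forall_congr' fun _ => forall_congr' fun h => forall_congr' fun _ =>
      not_congr (SB_succ _ _ _ h)
  have e3 : SB E (m+1) (m+1) := SB_of_le _ _ _ le_rfl
  unfold Good Semi
  rw [forall_Icc_succ, hasHub_last, indep_succ, e1, forall_Icc_succ, e2]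
  by_cases hE : m+1 ∈ E <;> by_cases hH : m+1 ∈ H <;> simp only [e3, hE, hH, true_and, false_and, or_false, false_or, not_true, not_false_iff, and_true, true_or, and_false, forall_true_left, true_implies, false_implies, implies_true, or_true]

theorem scan_iff (E H : Finset ℕ) (m : ℕ) :
    (scan E H m true ↔ Good E H (m+1)) ∧ (scan E H m false ↔ Semi E H (m+1)) := by
  induction m with
  | zero =>
    have e3 : SB E 1 1 := SB_of_le _ _ _ le_rfl
    have hi : Indep E H 1 := by intro j k; omega
    constructor
    · simp only [scan, Good, zero_add]
      constructor
      · intro h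
        refine ⟨fun i h1 h2 => ?_, hi⟩
        have : i = 1 := by omega
        subst this
        exact ⟨1, le_rfl, le_rfl, h, e3, e3⟩
      · rintro ⟨h, -⟩
        obtain ⟨j, h1, h2, h3, -⟩ := h 1 le_rfl le_rfl
        have : j = 1 := by omega
        exact this ▸ h3
    · simp only [scan, Semi, zero_add]
      constructor
      · intro h
        refine ⟨fun i h1 h2 => Or.inr (SB_of_le _ _ _ h1), hi, fun j h1 h2 h3 => ?_⟩
        have : j = 1 := by omega
        exact absurd (this ▸ h3) h
      · rintro ⟨-, -, h⟩ h1
        exact h 1 le_rfl le_rfl h1 e3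
  | succ m ih =>
    rw [good_succ E H (m+1) (by omega), semi_succ E H (m+1), ← ih.1, ← ih.2]
    exact ⟨Iff.rfl, Iff.rfl⟩

theorem scan_congr (E H E' H' : Finset ℕ) (m : ℕ) (hE : ∀ k ≤ m+1, k ∈ E ↔ k ∈ E')
    (hH : ∀ k ≤ m+1, k ∈ H ↔ k ∈ H') (b : Bool) : scan E H m b ↔ scan E' H' m b := by
  induction m generalizing b with
  | zero => cases b <;> simp [scan, hH 1]
  | succ m ih =>
    have := ih (fun k hk => hE k (by omega)) (fun k hk => hH k (by omega))
    cases b <;> simp only [scan, this, hE (m+2) le_rfl, hH (m+2) le_rfl]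

open Classical in
noncomputable def cnt (m : ℕ) (b : Bool) : ℕ :=
  ∑ E ∈ (Finset.Icc 2 (m+1)).powerset, ∑ H ∈ (Finset.Icc 1 (m+1)).powerset,
    if scan E H m b then 1 else 0

theorem cnt_zero (b : Bool) : cnt 0 b = 1 := by
  have : ({1} : Finset ℕ).powerset = ({∅, {1}} : Finset (Finset ℕ)) := by decide
  cases b <;> simp [cnt, scan, this]

open Classical in
theorem cnt_step (m : ℕ) (b : Bool) : cnt (m+1) b =
   ∑ E ∈ (Finset.Icc 2 (m+1)).powerset, ∑ H ∈ (Finset.Icc 1 (m+1)).powerset,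
    ((if scan E H (m+1) b then 1 else 0) + (if scan E (insert (m+2) H) (m+1) b then 1 else 0)
    + ((if scan (insert (m+2) E) H (m+1) b then 1 else 0) 
    + (if scan (insert (m+2) E) (insert (m+2) H) (m+1) b then 1 else 0))) := by
  have h1 : Finset.Icc 2 (m+1+1) = insert (m+2) (Finset.Icc 2 (m+1)) := by
    ext; simp; omega
  have h2 : Finset.Icc 1 (m+1+1) = insert (m+2) (Finset.Icc 1 (m+1)) := by
    ext; simp; omega
  rw [cnt, h1, h2, Finset.sum_powerset_insert (by simp)]
  simp only [Finset.sum_powerset_insert (show m+2 ∉ Finset.Icc 1 (m+1) by simp), Finset.sum_add_distrib]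

theorem scan_ins (E H : Finset ℕ) (m : ℕ) (b : Bool) :
    (scan (insert (m+2) E) H m b ↔ scan E H m b) ∧ (scan E (insert (m+2) H) m b ↔ scan E H m b) := by
  constructor <;> apply scan_congr <;> intro k hk <;> simp <;> omega

theorem cnt_true (m : ℕ) : cnt (m+1) true = 2 * cnt m true + cnt m false := by
  rw [cnt_step]
  simp only [cnt, Finset.mul_sum, ← Finset.sum_add_distrib]
  refine Finset.sum_congr rfl fun E hE => Finset.sum_congr rfl fun H hH => ?_
  have hE' : m+2 ∉ E := fun h => by simpa using Finset.mem_powerset.1 hE h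
  have hH' : m+2 ∉ H := fun h => by simpa using Finset.mem_powerset.1 hH h
  have p0 : scan E H (m+1) true ↔ False := by
    simp [scan, scan_ins, hE', hH']
  have p1 : scan E (insert (m+2) H) (m+1) true ↔ scan E H m true := by
    simp [scan, scan_ins, hE', hH']
  have p2 : scan (insert (m+2) E) H (m+1) true ↔ scan E H m true := by
    simp [scan, scan_ins, hE', hH']
  have p3 : scan (insert (m+2) E) (insert (m+2) H) (m+1) true ↔ scan E H m false := by
    simp [scan, scan_ins, hE', hH']
  by_cases q1 : scan E H m true <;> by_cases q2 : scan E H m false <;> simp [p0, p1, p2, p3, q1, q2]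

theorem cnt_false (m : ℕ) : cnt (m+1) false = cnt m true + cnt m false := by
  rw [cnt_step]
  simp only [cnt, ← Finset.sum_add_distrib]
  refine Finset.sum_congr rfl fun E hE => Finset.sum_congr rfl fun H hH => ?_
  have hE' : m+2 ∉ E := fun h => by simpa using Finset.mem_powerset.1 hE h
  have hH' : m+2 ∉ H := fun h => by simpa using Finset.mem_powerset.1 hH h
  have p0 : scan E H (m+1) false ↔ scan E H m true := by
    simp [scan, scan_ins, hE', hH']
  have p1 : scan E (insert (m+2) H) (m+1) false ↔ False := by
    simp [scan, scan_ins, hE', hH']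
  have p2 : scan (insert (m+2) E) H (m+1) false ↔ scan E H m false := by
    simp [scan, scan_ins, hE', hH']
  have p3 : scan (insert (m+2) E) (insert (m+2) H) (m+1) false ↔ False := by
    simp [scan, scan_ins, hE', hH']
  by_cases q1 : scan E H m true <;> by_cases q2 : scan E H m false <;> simp [p0, p1, p2, p3, q1, q2]

def compStep (m : ℕ) : Bool × Composition (m+1) → Composition (m+2)
  | (false, c) => ⟨1 :: c.blocks, by
      intro i hi; rcases List.mem_cons.1 hi with h | h
      · omega
      · exact c.blocks_pos h, by simp [c.blocks_sum]; omega⟩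
  | (true, c) => ⟨(c.blocks.headI + 1) :: c.blocks.tail, by
      intro i hi; rcases List.mem_cons.1 hi with h | h
      · omega
      · exact c.blocks_pos (List.mem_of_mem_tail h), by
        have := c.blocks_sum
        rcases hb : c.blocks with _ | ⟨a, l⟩
        · simp [hb] at this
        · simp [hb] at this ⊢; omega⟩

theorem comp_cons (m : ℕ) (c : Composition (m+1)) : ∃ a l, c.blocks = a :: l ∧ 0 < a := by
  have := c.blocks_sum
  rcases hb : c.blocks with _ | ⟨a, l⟩
  · simp [hb] at this
  · exact ⟨a, l, rfl, c.blocks_pos (by simp [hb])⟩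

theorem compStep_bij (m : ℕ) : Function.Bijective (compStep m) := by
  constructor
  · rintro ⟨b, c⟩ ⟨b', c'⟩ h
    obtain ⟨a, l, h1, h2⟩ := comp_cons m c
    obtain ⟨a', l', h1', h2'⟩ := comp_cons m c'
    have := congrArg Composition.blocks h
    cases b <;> cases b' <;> simp [compStep, h1, h1'] at this
    · simp [Composition.ext_iff, h1, h1', this]
    · omega
    · omega
    · simp [Composition.ext_iff, h1, h1', this]
  · intro c
    obtain ⟨a, l, h1, h2⟩ := comp_cons _ c
    have hs := c.blocks_sum
    rw [h1] at hs
    simp at hs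
    have hl : ∀ {i}, i ∈ l → 0 < i := fun hi => c.blocks_pos (by simp [h1, hi])
    by_cases ha : a = 1
    · refine ⟨(false, ⟨l, hl, by omega⟩), ?_⟩
      simp [compStep, Composition.ext_iff, h1, ha]
    · refine ⟨(true, ⟨(a-1) :: l, ?_, by simp; omega⟩), ?_⟩
      · intro i hi; rcases List.mem_cons.1 hi with h | h
        · omega
        · exact hl h
      · simp [compStep, Composition.ext_iff, h1]; omega

theorem sum_comp (m : ℕ) (f : List ℕ → ℕ) : ∑ c : Composition (m+2), f c.blocks =
    (∑ c : Composition (m+1), f ((c.blocks.headI + 1) :: c.blocks.tail)) + 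
     ∑ c : Composition (m+1), f (1 :: c.blocks) := by
  rw [← (compStep_bij m).sum_comp, Fintype.sum_prod_type]
  simp [compStep]

theorem comp_one (f : List ℕ → ℕ) : ∑ c : Composition 1, f c.blocks = f [1] := by
  have : ∀ c : Composition 1, c.blocks = [1] := by
    intro c
    obtain ⟨a, l, h1, h2⟩ := comp_cons 0 c
    have hs := c.blocks_sum
    rw [h1] at hs
    simp at hs
    rcases l with _ | ⟨b, l⟩
    · simp at hs; simp [h1, hs]
    · have := c.blocks_pos (i := b) (by simp [h1])
      simp at hs; omega
  simp [this, composition_card]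

theorem cnt_eq (m : ℕ) : cnt m true = ∑ c : Composition (m+1), c.blocks.prod ∧
   cnt m false = ∑ c : Composition (m+1), c.blocks.tail.prod := by
  induction m with
  | zero =>
    rw [cnt_zero, cnt_zero, comp_one List.prod, comp_one (fun l => l.tail.prod)]
    simp
  | succ m ih =>
    rw [cnt_true, cnt_false, ih.1, ih.2, sum_comp m List.prod, sum_comp m (fun l => l.tail.prod)]
    have : ∀ c : Composition (m+1), ((c.blocks.headI + 1) :: c.blocks.tail).prod =
      c.blocks.prod + c.blocks.tail.prod := by
      intro c
      obtain ⟨a, l, h1, h2⟩ := comp_cons m c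
      simp [h1]; ring
    simp only [this, Finset.sum_add_distrib]
    simp
    constructor <;> ring

/-- The spanning subgraph of the fan with path edges coded by `E`, hub edges by `H`. -/
def codeGraph (n : ℕ) (E H : Finset ℕ) : SimpleGraph (Fin n) :=
  SimpleGraph.fromRel (fun i j =>
    ((i : ℕ) = 0 ∧ (j : ℕ) ∈ H) ∨ ((i : ℕ) + 1 = (j : ℕ) ∧ (j : ℕ) ∈ E))

theorem codeGraph_adj (n : ℕ) (E H : Finset ℕ) (hH : ∀ k ∈ H, 1 ≤ k) (i j : Fin n) :
    (codeGraph n E H).Adj i j ↔ ((i : ℕ) = 0 ∧ (j : ℕ) ∈ H) ∨ ((j : ℕ) = 0 ∧ (i : ℕ) ∈ H) ∨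
      ((i : ℕ) + 1 = j ∧ (j : ℕ) ∈ E) ∨ ((j : ℕ) + 1 = i ∧ (i : ℕ) ∈ E) := by
  have h0 : 0 ∉ H := fun h => absurd (hH 0 h) (by omega)
  rw [codeGraph, SimpleGraph.fromRel_adj]
  constructor
  · tauto
  · intro h
    refine ⟨?_, by tauto⟩
    rintro rfl
    rcases h with h | h | h | h
    · exact h0 (h.1 ▸ h.2)
    · exact h0 (h.1 ▸ h.2)
    · omega
    · omega

theorem reach_of_path (n : ℕ) (G : SimpleGraph (Fin n)) (i : Fin n) (j : ℕ) (hj : j < n)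
    (hij : (i : ℕ) ≤ j)
    (h : ∀ a b : Fin n, (i : ℕ) ≤ a → (a : ℕ) + 1 = b → (b : ℕ) ≤ j → G.Adj a b) :
    G.Reachable i ⟨j, hj⟩ := by
  induction j with
  | zero =>
    have : i = ⟨0, hj⟩ := Fin.ext (by simpa using hij)
    rw [this]
  | succ j ih =>
    rcases Nat.lt_or_ge j (i : ℕ) with h1 | h1
    · have : i = ⟨j+1, hj⟩ := Fin.ext (by simp; omega)
      rw [this]
    · have h2 := ih (by omega) h1 (fun a b h3 h4 h5 => h a b h3 h4 (by omega))
      exact h2.trans (h ⟨j, by omega⟩ ⟨j+1, hj⟩ h1 rfl le_rfl).reachable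

theorem reach_closed {V : Type*} (G : SimpleGraph V) (S : V → Prop)
    (hS : ∀ a b, G.Adj a b → S a → S b) {a b : V} (h : G.Reachable a b) (ha : S a) : S b := by
  obtain ⟨p⟩ := h
  induction p with
  | nil => exact ha
  | cons h p ih => exact ih (hS _ _ h ha)

/-- Same block. -/
def Same (E : Finset ℕ) (i j : ℕ) : Prop := SB E i j ∧ SB E j i

theorem Same.step {E : Finset ℕ} {i a b : ℕ} (h : Same E i a) (hab : a + 1 = b) (hb : b ∈ E) :
    Same E i b := by
  constructor
  · intro k h1 h2
    rcases Nat.lt_or_ge a k with h3 | h3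
    · have : k = b := by omega
      exact this ▸ hb
    · exact h.1 k h1 h3
  · intro k h1 h2
    exact h.2 k (by omega) h2

theorem Same.step' {E : Finset ℕ} {i a b : ℕ} (h : Same E i b) (hab : a + 1 = b) (hb : b ∈ E) :
    Same E i a := by
  constructor
  · intro k h1 h2
    exact h.1 k h1 (by omega)
  · intro k h1 h2
    rcases Nat.lt_or_ge b k with h3 | h3
    · exact h.2 k h3 h2
    · have : k = b := by omega
      exact this ▸ hb

theorem Same.refl (E : Finset ℕ) (i : ℕ) : Same E i i := ⟨SB_of_le _ _ _ le_rfl, SB_of_le _ _ _ le_rfl⟩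

theorem Same.trans' {E : Finset ℕ} {i j k : ℕ} (h1 : Same E i j) (h2 : Same E i k) : Same E j k := by
  constructor
  · intro l h3 h4
    rcases Nat.lt_or_ge i l with h5 | h5
    · exact h2.1 l h5 h4
    · exact h1.2 l h3 h5
  · intro l h3 h4
    rcases Nat.lt_or_ge i l with h5 | h5
    · exact h1.1 l h5 h4
    · exact h2.2 l h3 h5

theorem Indep.eq {E H : Finset ℕ} {m : ℕ} (h : Indep E H m) {j k : ℕ} (hj : 1 ≤ j) (hj' : j ≤ m)
    (hk : 1 ≤ k) (hk' : k ≤ m) (h1 : j ∈ H) (h2 : k ∈ H) (h3 : Same E j k) : j = k := by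
  rcases lt_trichotomy j k with h4 | h4 | h4
  · exact absurd h3.1 (h j k hj h4 hk' h1 h2)
  · exact h4
  · exact absurd h3.2 (h k j hk h4 hj' h2 h1)

theorem tree_good (m : ℕ) (E H : Finset ℕ) (hE : ∀ k ∈ E, 2 ≤ k) (hH : ∀ k ∈ H, 1 ≤ k)
    (hT : (codeGraph (m+1) E H).IsTree) : Good E H m := by
  have hadj := codeGraph_adj (m+1) E H hH
  constructor
  · intro i h1 h2
    by_contra hc
    have hr := hT.connected.preconnected (⟨i, by omega⟩ : Fin (m+1)) 0
    have := reach_closed _ (fun a : Fin (m+1) => 1 ≤ (a : ℕ) ∧ Same E i a) ?_ hr ⟨h1, Same.refl E i⟩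
    · simp at this
    · rintro a b hab ⟨h3, h4⟩
      rcases (hadj a b).1 hab with h | h | h | h
      · omega
      · exact absurd ⟨a, h3, by omega, h.2, h4⟩ hc
      · exact ⟨by omega, h4.step h.1 h.2⟩
      · have := hE _ h.2
        exact ⟨by omega, h4.step' h.1 h.2⟩
  · intro j k h1 h2 h3 h4 h5 h6
    have hb := SimpleGraph.isAcyclic_iff_forall_adj_isBridge.1 hT.isAcyclic
      (v := (0 : Fin (m+1))) (w := ⟨k, by omega⟩) ((hadj _ _).2 (Or.inl ⟨rfl, h5⟩))
    rw [SimpleGraph.isBridge_iff] at hb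
    apply hb
    have ha : ((codeGraph (m+1) E H).deleteEdges {s((0 : Fin (m+1)), ⟨k, by omega⟩)}).Adj 0
        ⟨j, by omega⟩ := by
      rw [SimpleGraph.deleteEdges_adj]
      refine ⟨(hadj _ _).2 (Or.inl ⟨rfl, h4⟩), ?_⟩
      simp [Fin.ext_iff]
      omega
    refine ha.reachable.trans (reach_of_path _ _ _ _ _ (by simp; omega) ?_)
    intro a b h7 h8 h9
    simp at h7
    rw [SimpleGraph.deleteEdges_adj]
    refine ⟨(hadj _ _).2 (Or.inr (Or.inr (Or.inl ⟨h8, h6 b (by omega) h9⟩))), ?_⟩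
    rw [Set.mem_singleton_iff, Sym2.eq_iff]
    simp only [Fin.ext_iff, Fin.val_zero]
    omega

theorem good_tree (m : ℕ) (E H : Finset ℕ) (hE : ∀ k ∈ E, 2 ≤ k) (hH : ∀ k ∈ H, 1 ≤ k)
    (hG : Good E H m) : (codeGraph (m+1) E H).IsTree := by
  have hadj := codeGraph_adj (m+1) E H hH
  obtain ⟨hG1, hG2⟩ := hG
  rw [SimpleGraph.isTree_iff]
  constructor
  · have hr : ∀ a : Fin (m+1), (codeGraph (m+1) E H).Reachable a 0 := by
      intro a
      rcases Nat.eq_zero_or_pos (a : ℕ) with h0 | h0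
      · have : a = 0 := Fin.ext h0
        rw [this]
      · obtain ⟨j, h1, h2, h3, h4, h5⟩ := hG1 a h0 (by omega)
        have e1 : (codeGraph (m+1) E H).Reachable ⟨j, by omega⟩ 0 :=
          ((hadj _ _).2 (Or.inr (Or.inl ⟨rfl, h3⟩))).reachable
        refine SimpleGraph.Reachable.trans ?_ e1
        rcases Nat.le_total (a : ℕ) j with h6 | h6
        · refine reach_of_path _ _ _ _ _ h6 ?_
          intro x y h7 h8 h9
          exact (hadj _ _).2 (Or.inr (Or.inr (Or.inl ⟨h8, h4 y (by omega) h9⟩)))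
        · refine (reach_of_path _ _ ⟨j, by omega⟩ a a.2 h6 ?_).symm
          intro x y h7 h8 h9
          simp at h7
          exact (hadj _ _).2 (Or.inr (Or.inr (Or.inl ⟨h8, h5 y (by omega) h9⟩)))
    exact ⟨fun a b => (hr a).trans (hr b).symm⟩
  · rw [SimpleGraph.isAcyclic_iff_forall_adj_isBridge]
    -- a hub edge is a bridge
    have hub : ∀ a b : Fin (m+1), (a : ℕ) = 0 → (b : ℕ) ∈ H →
        (codeGraph (m+1) E H).IsBridge s(b, a) := by
      intro a b h0 hb
      rw [SimpleGraph.isBridge_iff]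
      intro hr
      have hb1 := hH _ hb
      have := reach_closed _ (fun x : Fin (m+1) => 1 ≤ (x : ℕ) ∧ Same E b x) ?_ hr
        ⟨hb1, Same.refl E b⟩
      · omega
      · rintro x y hxy ⟨h3, h4⟩
        rw [SimpleGraph.deleteEdges_adj] at hxy
        obtain ⟨hxy, hne⟩ := hxy
        rcases (hadj x y).1 hxy with h | h | h | h
        · omega
        · have e := hG2.eq hb1 (by omega) h3 (by omega) hb h.2 h4
          exfalso; apply hne
          have e1 : b = x := Fin.ext e
          have e2 : a = y := Fin.ext (by omega)
          simp [e1, e2]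
        · exact ⟨by omega, h4.step h.1 h.2⟩
        · have := hE _ h.2
          exact ⟨by omega, h4.step' h.1 h.2⟩
    -- a path edge is a bridge
    have pth : ∀ a b : Fin (m+1), (a : ℕ) + 1 = b → (b : ℕ) ∈ E →
        (codeGraph (m+1) E H).IsBridge s(a, b) := by
      intro a b h0 hb
      rw [SimpleGraph.isBridge_iff]
      intro hr
      have hb1 := hE _ hb
      obtain ⟨j, h1, h2, h3, h4⟩ := hG1 a (by omega) (by omega)
      have h4 : Same E a j := h4
      rcases Nat.le_total j (a : ℕ) with h5 | h5
      · have := reach_closed _ (fun x : Fin (m+1) => (b : ℕ) ≤ (x : ℕ) ∧ Same E a x) ?_ hr.symm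
          ⟨le_rfl, (Same.refl E a).step h0 hb⟩
        · omega
        · rintro x y hxy ⟨h6, h7⟩
          rw [SimpleGraph.deleteEdges_adj] at hxy
          obtain ⟨hxy, hne⟩ := hxy
          rcases (hadj x y).1 hxy with h | h | h | h
          · omega
          · have e := hG2.eq h1 h2 (by omega) (by omega) h3 h.2 (h4.trans' h7)
            omega
          · exact ⟨by omega, h7.step h.1 h.2⟩
          · refine ⟨?_, h7.step' h.1 h.2⟩
            by_contra hc
            apply hne
            have e1 : x = b := Fin.ext (by omega)
            have e2 : y = a := Fin.ext (by omega)
            simp [e1, e2]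
      · rcases Nat.eq_or_lt_of_le h5 with h5' | h5'
        · have := reach_closed _ (fun x : Fin (m+1) => (b : ℕ) ≤ (x : ℕ) ∧ Same E a x) ?_ hr.symm
            ⟨le_rfl, (Same.refl E a).step h0 hb⟩
          · omega
          · rintro x y hxy ⟨h6, h7⟩
            rw [SimpleGraph.deleteEdges_adj] at hxy
            obtain ⟨hxy, hne⟩ := hxy
            rcases (hadj x y).1 hxy with h | h | h | h
            · omega
            · have e := hG2.eq h1 h2 (by omega) (by omega) h3 h.2 (h4.trans' h7)
              omega
            · exact ⟨by omega, h7.step h.1 h.2⟩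
            · refine ⟨?_, h7.step' h.1 h.2⟩
              by_contra hc
              apply hne
              have e1 : x = b := Fin.ext (by omega)
              have e2 : y = a := Fin.ext (by omega)
              simp [e1, e2]
        · have := reach_closed _ (fun x : Fin (m+1) => (1 ≤ (x : ℕ) ∧ (x : ℕ) ≤ a) ∧ Same E a x) ?_ hr
            ⟨by omega, Same.refl E a⟩
          · omega
          · rintro x y hxy ⟨h6, h7⟩
            rw [SimpleGraph.deleteEdges_adj] at hxy
            obtain ⟨hxy, hne⟩ := hxy
            rcases (hadj x y).1 hxy with h | h | h | h
            · omega
            · have e := hG2.eq h1 h2 (by omega) (by omega) h3 h.2 (h4.trans' h7)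
              omega
            · refine ⟨?_, h7.step h.1 h.2⟩
              by_contra hc
              apply hne
              have e1 : x = a := Fin.ext (by omega)
              have e2 : y = b := Fin.ext (by omega)
              simp [e1, e2]
            · have := hE _ h.2
              exact ⟨by omega, h7.step' h.1 h.2⟩
    intro v w hvw
    rcases (hadj v w).1 hvw with h | h | h | h
    · rw [Sym2.eq_swap]; exact hub v w h.1 h.2
    · exact hub w v h.1 h.2
    · exact pth v w h.1 h.2
    · rw [Sym2.eq_swap]; exact pth w v h.1 h.2

theorem fan_adj (n : ℕ) (i j : Fin n) : (fanGraph n).Adj i j ↔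
    ((i : ℕ) = 0 ∧ (j : ℕ) ≠ 0) ∨ ((j : ℕ) = 0 ∧ (i : ℕ) ≠ 0) ∨
      ((i : ℕ) ≠ 0 ∧ (i : ℕ) + 1 = j) ∨ ((j : ℕ) ≠ 0 ∧ (j : ℕ) + 1 = i) := by
  rw [fanGraph, SimpleGraph.fromRel_adj, Ne, Fin.ext_iff]
  omega

open Classical in
noncomputable def codes (m : ℕ) : Finset (Finset ℕ × Finset ℕ) :=
  ((Finset.Icc 2 (m+1)).powerset ×ˢ (Finset.Icc 1 (m+1)).powerset).filter
    (fun p => scan p.1 p.2 m true)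

theorem card_codes (m : ℕ) : (codes m).card = cnt m true := by
  classical
  rw [codes, Finset.card_filter, Finset.sum_product, cnt]

theorem mem_codes (m : ℕ) (p : Finset ℕ × Finset ℕ) : p ∈ codes m ↔
    (p.1 ⊆ Finset.Icc 2 (m+1) ∧ p.2 ⊆ Finset.Icc 1 (m+1)) ∧ Good p.1 p.2 (m+1) := by
  classical
  rw [codes, Finset.mem_filter, Finset.mem_product, Finset.mem_powerset, Finset.mem_powerset,
    (scan_iff p.1 p.2 m).1]

theorem code_span (m : ℕ) (p : codes m) :
    IsSpanningTree (fanGraph (m+2)) (codeGraph (m+2) p.1.1 p.1.2) := by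
  obtain ⟨⟨E, H⟩, hp⟩ := p
  obtain ⟨⟨h1, h2⟩, h3⟩ := (mem_codes m _).1 hp
  have hE : ∀ k ∈ E, 2 ≤ k := fun k hk => (Finset.mem_Icc.1 (h1 hk)).1
  have hH : ∀ k ∈ H, 1 ≤ k := fun k hk => (Finset.mem_Icc.1 (h2 hk)).1
  refine ⟨?_, good_tree _ _ _ hE hH h3⟩
  intro i j hij
  rw [fan_adj]
  rcases (codeGraph_adj _ _ _ hH i j).1 hij with h | h | h | h
  · have := hH _ h.2
    omega
  · have := hH _ h.2
    omega
  · have := hE _ h.2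
    omega
  · have := hE _ h.2
    omega

theorem num_eq (m : ℕ) : numSpanningTrees (m+2) = cnt m true := by
  classical
  rw [← card_codes, numSpanningTrees, ← Nat.card_eq_finsetCard]
  symm
  refine Nat.card_eq_of_bijective (fun p : codes m => ⟨_, code_span m p⟩) ⟨?_, ?_⟩
  · rintro ⟨⟨E, H⟩, hp⟩ ⟨⟨E', H'⟩, hp'⟩ h
    have hg : codeGraph (m+2) E H = codeGraph (m+2) E' H' := congrArg Subtype.val h
    obtain ⟨⟨h1, h2⟩, -⟩ := (mem_codes m _).1 hp
    obtain ⟨⟨h1', h2'⟩, -⟩ := (mem_codes m _).1 hp'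
    have hH : ∀ k ∈ H, 1 ≤ k := fun k hk => (Finset.mem_Icc.1 (h2 hk)).1
    have hH' : ∀ k ∈ H', 1 ≤ k := fun k hk => (Finset.mem_Icc.1 (h2' hk)).1
    have key : ∀ i j : Fin (m+2), _ ↔ _ := fun i j =>
      (codeGraph_adj _ E H hH i j).symm.trans ((by rw [hg]) : _ ↔ (codeGraph (m+2) E' H').Adj i j)
        |>.trans (codeGraph_adj _ E' H' hH' i j)
    have eE : E = E' := by
      ext k
      by_cases hk : k ∈ Finset.Icc 2 (m+1)
      · rw [Finset.mem_Icc] at hk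
        have := key ⟨k-1, by omega⟩ ⟨k, by omega⟩
        have a1 : k - 1 + 1 = k := by omega
        have a2 : k - 1 ≠ 0 := by omega
        have a3 : k ≠ 0 := by omega
        have a4 : k + 1 ≠ k - 1 := by omega
        simpa [a1, a2, a3, a4] using this
      · exact ⟨fun h => absurd (h1 h) hk, fun h => absurd (h1' h) hk⟩
    have eH : H = H' := by
      ext k
      by_cases hk : k ∈ Finset.Icc 1 (m+1)
      · rw [Finset.mem_Icc] at hk
        have := key 0 ⟨k, by omega⟩
        have a3 : k ≠ 0 := by omega
        have b1 : 1 ∉ E := fun h => by simpa using h1 h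
        have b2 : 1 ∉ E' := fun h => by simpa using h1' h
        have b3 : ∀ P : Finset ℕ, 1 ∉ P → ¬ (1 = k ∧ k ∈ P) := by
          rintro P hP ⟨rfl, h⟩
          exact hP h
        simpa [a3, b3 E b1, b3 E' b2] using this
      · exact ⟨fun h => absurd (h2 h) hk, fun h => absurd (h2' h) hk⟩
    subst eE eH
    rfl
  · rintro ⟨T, hT1, hT2⟩
    let E := (Finset.Icc 2 (m+1)).filter
      (fun k => ∃ a b : Fin (m+2), (a : ℕ) + 1 = k ∧ (b : ℕ) = k ∧ T.Adj a b)
    let H := (Finset.Icc 1 (m+1)).filter (fun k => ∃ b : Fin (m+2), (b : ℕ) = k ∧ T.Adj 0 b)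
    have hEs : E ⊆ Finset.Icc 2 (m+1) := Finset.filter_subset _ _
    have hHs : H ⊆ Finset.Icc 1 (m+1) := Finset.filter_subset _ _
    have hE : ∀ k ∈ E, 2 ≤ k := fun k hk => (Finset.mem_Icc.1 (hEs hk)).1
    have hH : ∀ k ∈ H, 1 ≤ k := fun k hk => (Finset.mem_Icc.1 (hHs hk)).1
    have pE : ∀ a b : Fin (m+2), (a : ℕ) + 1 = b → (b : ℕ) ∈ E → T.Adj a b := by
      intro a b h1 h2
      obtain ⟨-, a', b', h3, h4, h5⟩ := Finset.mem_filter.1 h2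
      have e1 : a' = a := Fin.ext (by omega)
      have e2 : b' = b := Fin.ext h4
      exact e1 ▸ e2 ▸ h5
    have pH : ∀ a b : Fin (m+2), (a : ℕ) = 0 → (b : ℕ) ∈ H → T.Adj a b := by
      intro a b h1 h2
      obtain ⟨-, b', h4, h5⟩ := Finset.mem_filter.1 h2
      have e1 : 0 = a := Fin.ext (by simp [h1])
      have e2 : b' = b := Fin.ext h4
      exact e1 ▸ e2 ▸ h5
    have qE : ∀ a b : Fin (m+2), (a : ℕ) ≠ 0 → (a : ℕ) + 1 = b → T.Adj a b → (b : ℕ) ∈ E := by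
      intro a b h0 h1 h2
      exact Finset.mem_filter.2 ⟨Finset.mem_Icc.2 (by omega), a, b, h1, rfl, h2⟩
    have qH : ∀ a b : Fin (m+2), (a : ℕ) = 0 → (b : ℕ) ≠ 0 → T.Adj a b → (b : ℕ) ∈ H := by
      intro a b h0 h1 h2
      have e1 : a = 0 := Fin.ext (by simp [h0])
      exact Finset.mem_filter.2 ⟨Finset.mem_Icc.2 (by omega), b, rfl, e1 ▸ h2⟩
    have hg : codeGraph (m+2) E H = T := by
      ext i j
      rw [codeGraph_adj _ E H hH]
      constructor
      · rintro (h | h | h | h)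
        · exact pH _ _ h.1 h.2
        · exact (pH _ _ h.1 h.2).symm
        · exact pE _ _ h.1 h.2
        · exact (pE _ _ h.1 h.2).symm
      · intro h
        rcases (fan_adj _ _ _).1 (hT1 h) with h' | h' | h' | h'
        · exact Or.inl ⟨h'.1, qH _ _ h'.1 h'.2 h⟩
        · exact Or.inr (Or.inl ⟨h'.1, qH _ _ h'.1 h'.2 h.symm⟩)
        · exact Or.inr (Or.inr (Or.inl ⟨h'.2, qE _ _ h'.1 h'.2 h⟩))
        · exact Or.inr (Or.inr (Or.inr ⟨h'.2, qE _ _ h'.1 h'.2 h.symm⟩))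
    refine ⟨⟨(E, H), (mem_codes m _).2 ⟨⟨hEs, hHs⟩, tree_good _ _ _ hE hH ?_⟩⟩, ?_⟩
    · show (codeGraph (m+2) E H).IsTree
      rw [hg]; exact hT2
    · exact Subtype.ext hg

theorem fan_count_eq_composition_sum (n : ℕ) (hn : 2 ≤ n) :
    numSpanningTrees n = ∑ c : Composition (n - 1), c.blocks.prod := by
  obtain ⟨m, rfl⟩ : ∃ m, n = m + 2 := ⟨n - 2, by omega⟩
  rw [num_eq, (cnt_eq m).1]
  rfl
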